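/- Let Φ be an Orlicz function and let p, q be reals with 1 < p < p_Φ ≤ q_Φ < q < ∞, where p_Φ, q_Φ are the Matuzewska–Orlicz indices of Φ. Then there exist constants c, C > 0, depending only on Φ, p and q, such that for every nonincreasing function g : (0,∞) → [0,∞) with ∫₀^∞ Φ(t^{−1/q} g(t^{1/p−1/q})) dt < ∞, one has c ∫₀^∞ Φ(t^{−1/q} g(t^{1/p−1/q})) dt ≤ ∫₀^∞ Φ(t^{−1/q} S_{1,∞}g(t^{1/p−1/q})) dt ≤ C ∫₀^∞ Φ(t^{−1/q} g(t^{1/p−1/q})) dt, where S_{1,∞}g(s) = s⁻¹ ∫₀^s g(w) dw. -/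

import Mathlib

open MeasureTheory Filter Set

/-- An Orlicz function: continuous, increasing and convex on `[0,∞)`, vanishing at `0`,
and tending to `∞` at `∞`. -/
structure IsOrliczFunction (Φ : ℝ → ℝ) : Prop where
  map_zero : Φ 0 = 0
  continuousOn : ContinuousOn Φ (Set.Ici 0)
  monotoneOn : MonotoneOn Φ (Set.Ici 0)
  convexOn : ConvexOn ℝ (Set.Ici 0) Φ
  tendsto_atTop : Filter.Tendsto Φ Filter.atTop Filter.atTop

/-- The `Δ₂`-condition: `Φ(2t) ≤ C Φ(t)` for all `t ≥ 0` and some constant `C > 0`. -/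
def Delta2 (Φ : ℝ → ℝ) : Prop :=
  ∃ C : ℝ, 0 < C ∧ ∀ t : ℝ, 0 ≤ t → Φ (2 * t) ≤ C * Φ t

/-- `M(t,Φ) = sup_{s>0} Φ(ts)/Φ(s)`. -/
noncomputable def orliczM (Φ : ℝ → ℝ) (t : ℝ) : ℝ :=
  sSup {r : ℝ | ∃ s : ℝ, 0 < s ∧ r = Φ (t * s) / Φ s}

/-- `p` and `q` are the Matuzewska–Orlicz indices of `Φ`:
`p = lim_{t→0⁺} log M(t,Φ)/log t` and `q = lim_{t→∞} log M(t,Φ)/log t`. -/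
def HasMatuzewskaOrliczIndices (Φ : ℝ → ℝ) (p q : ℝ) : Prop :=
  Filter.Tendsto (fun t : ℝ => Real.log (orliczM Φ t) / Real.log t)
      (nhdsWithin 0 (Set.Ioi 0)) (nhds p) ∧
  Filter.Tendsto (fun t : ℝ => Real.log (orliczM Φ t) / Real.log t)
      Filter.atTop (nhds q)

/-- The Calderón operator `S_{1,∞} g(s) = s⁻¹ ∫₀^s g(w) dw`. -/
noncomputable def S1inf (g : ℝ → ℝ) (s : ℝ) : ℝ :=
  s⁻¹ * ∫ w in (0:ℝ)..s, g w


lemma orl_nonneg {Φ : ℝ → ℝ} (hΦ : IsOrliczFunction Φ) {x : ℝ} (hx : 0 ≤ x) : 0 ≤ Φ x := by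
  have := hΦ.monotoneOn (mem_Ici.2 le_rfl) (mem_Ici.2 hx) hx
  rwa [hΦ.map_zero] at this

lemma orl_bdd_of_ne {Φ : ℝ → ℝ} {t : ℝ} (h : orliczM Φ t ≠ 0) {s : ℝ} (hs : 0 < s) :
    Φ (t * s) / Φ s ≤ orliczM Φ t := by
  have hb : BddAbove {r : ℝ | ∃ s : ℝ, 0 < s ∧ r = Φ (t * s) / Φ s} := by
    by_contra hb
    exact h (Real.sSup_of_not_bddAbove hb)
  exact le_csSup hb ⟨s, hs, rfl⟩

lemma orl_M_nonneg {Φ : ℝ → ℝ} (hΦ : IsOrliczFunction Φ) {t : ℝ} (ht : 0 ≤ t) :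
    0 ≤ orliczM Φ t := by
  apply Real.sSup_nonneg
  rintro r ⟨s, hs, rfl⟩
  exact div_nonneg (orl_nonneg hΦ (by positivity)) (orl_nonneg hΦ hs.le)

lemma orl_ev {Φ : ℝ → ℝ} {pΦ qΦ : ℝ} (hMO : HasMatuzewskaOrliczIndices Φ pΦ qΦ) (hq : 1 < qΦ)
    (T : ℝ) : ∃ t, T ≤ t ∧ orliczM Φ t ≠ 0 := by
  have h1 := hMO.2.eventually (lt_mem_nhds hq)
  obtain ⟨t, h2, h3⟩ := (h1.and (eventually_ge_atTop T)).exists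
  refine ⟨t, h3, fun h => ?_⟩
  rw [h] at h2
  simp at h2
  linarith

lemma orl_pos {Φ : ℝ → ℝ} (hΦ : IsOrliczFunction Φ) {pΦ qΦ : ℝ}
    (hMO : HasMatuzewskaOrliczIndices Φ pΦ qΦ) (hq : 1 < qΦ) {s : ℝ} (hs : 0 < s) : 0 < Φ s := by
  rcases (orl_nonneg hΦ hs.le).lt_or_eq with h | h0
  · exact h
  exfalso
  obtain ⟨S, hS1, hS0⟩ := ((hΦ.tendsto_atTop.eventually_ge_atTop 1).and
    (eventually_ge_atTop s)).exists
  obtain ⟨t, ht, hne⟩ := orl_ev hMO hq (S / s)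
  have hS : 0 < S := hs.trans_le hS0
  have ht0 : 0 < t := lt_of_lt_of_le (by positivity) ht
  set m := orliczM Φ t with hm
  have hm0 : 0 ≤ m := orl_M_nonneg hΦ ht0.le
  set η : ℝ := 1 / (m + 1) with hη
  have hη0 : 0 < η := by positivity
  have hη1 : η ≤ 1 := by rw [hη, div_le_one (by positivity)]; linarith
  have hiv := intermediate_value_Icc hS0 (hΦ.continuousOn.mono (fun x hx => hs.le.trans hx.1))
  obtain ⟨s2, hs2, hs2'⟩ := hiv ⟨h0 ▸ hη0.le, hη1.trans hS1⟩
  have hs20 : 0 < s2 := hs.trans_le hs2.1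
  have h3 := orl_bdd_of_ne hne hs20
  have h4 : 1 ≤ Φ (t * s2) := by
    refine hS1.trans (hΦ.monotoneOn hS.le (mem_Ici.2 (by positivity)) ?_)
    rw [div_le_iff₀ hs] at ht
    exact ht.trans (by have := hs2.1; gcongr)
  rw [hs2', ← hm, div_le_iff₀ hη0, hη] at h3
  have : m * (1 / (m+1)) < 1 := by
    rw [mul_one_div, div_lt_one (by positivity)]; linarith
  linarith

lemma orl_delta {Φ : ℝ → ℝ} (hΦ : IsOrliczFunction Φ) {pΦ qΦ : ℝ}
    (hMO : HasMatuzewskaOrliczIndices Φ pΦ qΦ) (hq : 1 < qΦ) {l : ℝ} (hl : 0 ≤ l) :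
    ∃ C, 0 < C ∧ ∀ x, 0 ≤ x → Φ (l * x) ≤ C * Φ x := by
  obtain ⟨t, ht, hne⟩ := orl_ev hMO hq l
  have hM := orl_M_nonneg hΦ (hl.trans ht)
  refine ⟨orliczM Φ t, lt_of_le_of_ne hM hne.symm, fun x hx => ?_⟩
  rcases hx.eq_or_lt with rfl | hx'
  · simp [hΦ.map_zero]
  have h := orl_bdd_of_ne hne hx'
  rw [div_le_iff₀ (orl_pos hΦ hMO hq hx')] at h
  refine le_trans (hΦ.monotoneOn (mem_Ici.2 (by positivity)) (mem_Ici.2 ?_) ?_) h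
  · exact mul_nonneg (hl.trans ht) hx
  · gcongr

lemma orl_low {Φ : ℝ → ℝ} (hΦ : IsOrliczFunction Φ) {pΦ qΦ r : ℝ}
    (hMO : HasMatuzewskaOrliczIndices Φ pΦ qΦ) (hq : 1 < qΦ) (hr0 : 0 < r) (hr : r < pΦ) :
    ∃ K, 0 < K ∧ ∀ u x, 0 < u → u ≤ 1 → 0 ≤ x → Φ (u * x) ≤ K * u ^ r * Φ x := by
  have h1 := hMO.1.eventually (lt_mem_nhds hr)
  obtain ⟨t0, ht0, h2⟩ := mem_nhdsGT_iff_exists_Ioo_subset.1 h1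
  have ht0 : 0 < t0 := ht0
  set a := min t0 1
  have ha : 0 < a := lt_min ht0 one_pos
  have ha1 : a ≤ 1 := min_le_right _ _
  refine ⟨(a ^ r)⁻¹, by positivity, fun u x hu hu1 hx => ?_⟩
  have hK : 1 ≤ (a ^ r)⁻¹ := (one_le_inv₀ (by positivity)).2 (Real.rpow_le_one ha.le ha1 hr0.le)
  rcases hx.eq_or_lt with rfl | hx'
  · simp [hΦ.map_zero]
  have hpos := orl_pos hΦ hMO hq hx'
  rcases lt_or_ge u a with hua | hua
  · have h3 : r < Real.log (orliczM Φ u) / Real.log u :=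
      h2 ⟨hu, hua.trans_le (min_le_left _ _)⟩
    have hne : orliczM Φ u ≠ 0 := by
      intro h; rw [h] at h3; simp at h3; linarith
    have hM := lt_of_le_of_ne (orl_M_nonneg hΦ hu.le) hne.symm
    have hlog : Real.log u < 0 := Real.log_neg hu (hua.trans_le ha1)
    rw [lt_div_iff_of_neg hlog] at h3
    have h4 : orliczM Φ u ≤ u ^ r := by
      rw [← Real.log_le_log_iff hM (by positivity), Real.log_rpow hu]; exact h3.le
    have h := orl_bdd_of_ne hne hx'
    rw [div_le_iff₀ hpos] at h
    calc _ ≤ _ := h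
      _ ≤ u ^ r * Φ x := by gcongr
      _ ≤ _ := by
        rw [mul_assoc]; exact le_mul_of_one_le_left (by positivity) hK
  · have h5 : Φ (u * x) ≤ Φ x := hΦ.monotoneOn (mem_Ici.2 (by positivity)) hx
      (mul_le_of_le_one_left hx hu1)
    refine h5.trans (le_mul_of_one_le_left hpos.le ?_)
    rw [inv_mul_eq_div, one_le_div (by positivity)]
    gcongr

lemma key_int {g : ℝ → ℝ} (hg0 : ∀ t ∈ Ioi (0:ℝ), 0 ≤ g t) (hg : AntitoneOn g (Ioi 0))
    {ε s B : ℝ} (he : 0 < ε) (he1 : ε ≤ 1) (hs : 0 < s)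
    (hB : ∀ k : ℕ, 2 ^ (1 - ε) / ε * (((1/2:ℝ)^(k+1)) ^ (1 - ε) * g ((1/2:ℝ)^(k+1) * s)) ≤ B) :
    IntervalIntegrable g volume 0 s ∧ S1inf g s ≤ B := by
  have hpt : ∀ y ∈ Ioc 0 s, g y ≤ (ε * B * s ^ (1-ε)) * y ^ (ε - 1) := by
    intro y hy
    have hu0 : 0 < y / s := div_pos hy.1 hs
    have hu1 : y / s ≤ 1 := (div_le_one hs).2 hy.2
    obtain ⟨k, hk1, hk2⟩ := exists_nat_pow_near_of_lt_one hu0 hu1 (y := (1/2:ℝ)) (by norm_num)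
      (by norm_num)
    have hBk := hB k
    set d : ℝ := (1/2)^(k+1) with hd
    have hd0 : 0 < d := by positivity
    have h1 : y / s ≤ 2 * d := by rw [hd, pow_succ]; linarith
    have h2 : g y ≤ g (d * s) := by
      apply hg (mem_Ioi.2 (by positivity)) hy.1
      rw [lt_div_iff₀ hs] at hk1; exact hk1.le
    have h3 : (y / s) ^ (1-ε) ≤ 2 ^ (1-ε) * d ^ (1-ε) := by
      rw [← Real.mul_rpow (by norm_num) hd0.le]
      exact Real.rpow_le_rpow hu0.le h1 (by linarith)
    have h4 : (y/s)^(1-ε) * g y ≤ ε * B := by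
      have hgy := hg0 y hy.1
      calc _ ≤ (2 ^ (1-ε) * d ^ (1-ε)) * g (d * s) := by gcongr
        _ = ε * (2 ^ (1 - ε) / ε * (d ^ (1 - ε) * g (d * s))) := by field_simp
        _ ≤ _ := by gcongr
    rw [Real.div_rpow hy.1.le hs.le] at h4
    have hys : 0 < y ^ (1-ε) := Real.rpow_pos_of_pos hy.1 _
    have hss : 0 < s ^ (1-ε) := Real.rpow_pos_of_pos hs _
    have : y ^ (ε - 1) = (y ^ (1-ε))⁻¹ := by
      rw [← Real.rpow_neg hy.1.le]; congr 1; ring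
    rw [this, ← div_eq_mul_inv, le_div_iff₀ hys]
    rw [div_mul_eq_mul_div, div_le_iff₀ hss] at h4
    linarith
  have hii : IntervalIntegrable (fun y : ℝ => (ε * B * s ^ (1-ε)) * y ^ (ε - 1)) volume 0 s :=
    (intervalIntegral.intervalIntegrable_rpow' (by linarith)).const_mul _
  have hmeas : AEStronglyMeasurable g (volume.restrict (Ioc 0 s)) :=
    (aemeasurable_restrict_of_antitoneOn measurableSet_Ioc
      (hg.mono (fun x hx => hx.1))).aestronglyMeasurable
  have hgi : IntervalIntegrable g volume 0 s := by
    rw [intervalIntegrable_iff_integrableOn_Ioc_of_le hs.le] at hii ⊢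
    refine Integrable.mono' hii hmeas ?_
    filter_upwards [ae_restrict_mem measurableSet_Ioc] with y hy
    rw [Real.norm_of_nonneg (hg0 y hy.1)]
    exact hpt y hy
  refine ⟨hgi, ?_⟩
  have hI : ∫ y in (0:ℝ)..s, g y ≤ ∫ y in (0:ℝ)..s, (ε * B * s ^ (1-ε)) * y ^ (ε - 1) := by
    rw [intervalIntegral.integral_of_le hs.le, intervalIntegral.integral_of_le hs.le]
    rw [intervalIntegrable_iff_integrableOn_Ioc_of_le hs.le] at hii hgi
    exact setIntegral_mono_on hgi hii measurableSet_Ioc hpt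
  rw [intervalIntegral.integral_const_mul, integral_rpow (Or.inl (by linarith))] at hI
  have h0 : (0:ℝ) ^ (ε - 1 + 1) = 0 := Real.zero_rpow (by linarith)
  have h1 : s ^ (1-ε) * s ^ (ε - 1 + 1) = s := by
    rw [← Real.rpow_add hs]; ring_nf; simp
  have h2 : ε * B * s ^ (1-ε) * ((s ^ (ε - 1 + 1) - 0 ^ (ε - 1 + 1)) / (ε - 1 + 1)) = B * s := by
    rw [h0, sub_zero, show ε * B * s ^ (1-ε) * (s ^ (ε - 1 + 1) / (ε - 1 + 1))
      = ε * B * (s ^ (1-ε) * s ^ (ε - 1 + 1)) / (ε - 1 + 1) by ring, h1]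
    rw [sub_add_cancel]; field_simp
  rw [h2] at hI
  rw [S1inf, inv_mul_eq_div, div_le_iff₀ hs]
  exact hI

lemma lint_scale (F : ℝ → ENNReal) {a : ℝ} (ha : 0 < a) :
    ∫⁻ t in Ioi (0:ℝ), F (a * t) = ENNReal.ofReal a⁻¹ * ∫⁻ t in Ioi (0:ℝ), F t := by
  rw [← lintegral_indicator measurableSet_Ioi, ← lintegral_indicator measurableSet_Ioi]
  have h := Real.map_volume_mul_left ha.ne'
  have h2 : ∫⁻ t, (Ioi (0:ℝ)).indicator F t ∂(Measure.map (a * ·) volume)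
      = ∫⁻ t, (Ioi (0:ℝ)).indicator F (a * t) :=
    lintegral_map_equiv (μ := volume) _ (Homeomorph.mulLeft₀ a ha.ne').toMeasurableEquiv
  rw [h, lintegral_smul_measure, abs_of_pos (inv_pos.2 ha)] at h2
  rw [smul_eq_mul] at h2
  rw [h2]
  congr 1
  ext t
  simp only [indicator, mem_Ioi, mul_pos_iff_of_pos_left ha]

/-- the weighted Φ-moment equivalence for `S_{1,∞}` applied to
nonincreasing nonnegative functions, when `1 < p < p_Φ ≤ q_Φ < q < ∞`. -/
theorem statement6 (Φ : ℝ → ℝ) (hΦ : IsOrliczFunction Φ) (pΦ qΦ : ℝ)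
    (hMO : HasMatuzewskaOrliczIndices Φ pΦ qΦ) (p q : ℝ)
    (hp : 1 < p) (hppΦ : p < pΦ) (hpΦqΦ : pΦ ≤ qΦ) (hqΦq : qΦ < q) :
    ∃ c C : ℝ, 0 < c ∧ 0 < C ∧ ∀ g : ℝ → ℝ,
      (∀ t ∈ Set.Ioi (0:ℝ), 0 ≤ g t) → AntitoneOn g (Set.Ioi 0) →
      (∫⁻ t in Set.Ioi (0:ℝ),
          ENNReal.ofReal (Φ (t ^ (-(1/q)) * g (t ^ (1/p - 1/q))))) < ⊤ →
      ENNReal.ofReal c *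
          (∫⁻ t in Set.Ioi (0:ℝ),
            ENNReal.ofReal (Φ (t ^ (-(1/q)) * g (t ^ (1/p - 1/q))))) ≤
        (∫⁻ t in Set.Ioi (0:ℝ),
          ENNReal.ofReal (Φ (t ^ (-(1/q)) * S1inf g (t ^ (1/p - 1/q))))) ∧
      (∫⁻ t in Set.Ioi (0:ℝ),
          ENNReal.ofReal (Φ (t ^ (-(1/q)) * S1inf g (t ^ (1/p - 1/q))))) ≤
        ENNReal.ofReal C *
          ∫⁻ t in Set.Ioi (0:ℝ),
            ENNReal.ofReal (Φ (t ^ (-(1/q)) * g (t ^ (1/p - 1/q)))) := by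
  have hp0 : 0 < p := by linarith
  have hq0 : 0 < q := by linarith
  have hqΦ1 : 1 < qΦ := by linarith
  set θ : ℝ := 1/p - 1/q with hθ
  have hθ0 : 0 < θ := by
    rw [hθ, sub_pos]; exact one_div_lt_one_div_of_lt hp0 (by linarith)
  set r : ℝ := (p + pΦ) / 2 with hr
  have hrp : p < r := by rw [hr]; linarith
  have hr0 : 0 < r := by linarith
  have hrP : r < pΦ := by rw [hr]; linarith
  set e0 : ℝ := (1/p - 1/r) / θ with he0
  have he00 : 0 < e0 := by
    apply div_pos _ hθ0
    rw [sub_pos]; exact one_div_lt_one_div_of_lt hp0 hrp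
  set ε : ℝ := min (e0/2) 1 with hε
  have hε0 : 0 < ε := lt_min (by positivity) one_pos
  have hε1 : ε ≤ 1 := min_le_right _ _
  have hεe : ε < e0 := lt_of_le_of_lt (min_le_left _ _) (by linarith)
  set β : ℝ := 1 - ε + 1/(θ*q) with hβ
  have hβ0 : 0 < β := by
    have : 0 < 1/(θ*q) := by positivity
    rw [hβ]; linarith
  set γ : ℝ := β * r - 1/θ with hγ
  have hγ0 : 0 < γ := by
    have h1 : β = 1/(p*θ) - ε := by
      have h2 : 1 + 1/(θ*q) = 1/(p*θ) := by
        have : θ + 1/q = 1/p := by rw [hθ]; ring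
        calc 1 + 1/(θ*q) = (θ + 1/q)/θ := by field_simp
          _ = _ := by rw [this]; field_simp
      rw [hβ]; linarith
    have h3 : 1/(p*θ) - e0 = 1/(r*θ) := by
      rw [he0]; field_simp; ring
    have h4 : 1/(r*θ) < β := by rw [h1]; linarith
    have h5 : 1/(r*θ) * r = 1/θ := by field_simp
    rw [hγ, ← h5, sub_pos]
    exact mul_lt_mul_of_pos_right h4 hr0
  obtain ⟨K, hK0, hK⟩ := orl_low hΦ hMO hqΦ1 hr0 hrP
  set L : ℝ := 2 * (2 ^ (1-ε) / ε) with hL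
  have hL0 : 0 < L := by positivity
  obtain ⟨D, hD0, hD⟩ := orl_delta hΦ hMO hqΦ1 hL0.le
  set ρ : ℝ := (1/2:ℝ) ^ γ with hρ
  have hρ0 : 0 < ρ := by positivity
  have hρ1 : ρ < 1 := Real.rpow_lt_one (by norm_num) (by norm_num) hγ0
  have hsum : Summable (fun k : ℕ => D * K * ρ ^ (k+1)) := by
    apply Summable.mul_left
    exact (summable_nat_add_iff 1).2 (summable_geometric_of_lt_one hρ0.le hρ1)
  set C : ℝ := ∑' k : ℕ, D * K * ρ ^ (k+1) with hC
  have hC0 : 0 < C := hsum.tsum_pos (fun k => by positivity) 0 (by positivity)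
  refine ⟨1, C, one_pos, hC0, fun g hg0 hg hfin => ?_⟩
  set I := ∫⁻ t in Set.Ioi (0:ℝ), ENNReal.ofReal (Φ (t ^ (-(1/q)) * g (t ^ θ))) with hI
  let x : ℕ → ℝ → ℝ := fun k s =>
    2 ^ (1 - ε) / ε * (((1/2:ℝ)^(k+1)) ^ (1 - ε) * g ((1/2:ℝ)^(k+1) * s))
  have hx0 : ∀ k s, 0 < s → 0 ≤ x k s := by
    intro k s hs
    have := hg0 ((1/2:ℝ)^(k+1) * s) (mem_Ioi.2 (by positivity))
    positivity
  let f : ℕ → ℝ → ENNReal := fun k t =>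
    ENNReal.ofReal (Φ (t ^ (-(1/q)) * (2 * x k (t ^ θ))))
  have hfm : ∀ k, AEMeasurable (f k) (volume.restrict (Ioi 0)) := by
    intro k
    have h1 : AEMeasurable (fun t : ℝ => g ((1/2:ℝ)^(k+1) * t ^ θ)) (volume.restrict (Ioi 0)) := by
      refine aemeasurable_restrict_of_antitoneOn measurableSet_Ioi ?_
      intro a ha b hb hab
      have ha : 0 < a := ha
      have hb : 0 < b := hb
      refine hg (mem_Ioi.2 (by positivity)) (mem_Ioi.2 (by positivity)) ?_
      gcongr
    have h2 : AEMeasurable (fun t : ℝ => t ^ (-(1/q)) * (2 * x k (t ^ θ)))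
        (volume.restrict (Ioi 0)) := by
      apply AEMeasurable.mul (by fun_prop)
      exact ((h1.const_mul _).const_mul _).const_mul _
    have h3 : Measurable (fun y : ℝ => Φ (max y 0)) := by
      apply Monotone.measurable
      intro a b hab
      exact hΦ.monotoneOn (mem_Ici.2 (le_max_right _ _)) (mem_Ici.2 (le_max_right _ _))
        (max_le_max_right _ hab)
    refine ((h3.comp_aemeasurable h2).ennreal_ofReal).congr ?_
    filter_upwards [ae_restrict_mem measurableSet_Ioi] with t ht
    have ht : 0 < t := ht
    have := hx0 k (t ^ θ) (by positivity)
    simp only [f, Function.comp]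
    rw [max_eq_left (by positivity)]
  have hfk : ∀ k, ∫⁻ t in Ioi (0:ℝ), f k t ≤ ENNReal.ofReal (D * K * ρ ^ (k+1)) * I := by
    intro k
    set d : ℝ := (1/2:ℝ)^(k+1) with hd
    have hd0 : 0 < d := by positivity
    have hd1 : d ≤ 1 := pow_le_one₀ (by norm_num) (by norm_num)
    set a : ℝ := d ^ (1/θ) with ha
    have ha0 : 0 < a := by positivity
    let F : ℝ → ENNReal := fun t =>
      ENNReal.ofReal (Φ (L * (d ^ β * (t ^ (-(1/q)) * g (t ^ θ)))))
    have h1 : ∫⁻ t in Ioi (0:ℝ), f k t = ∫⁻ t in Ioi (0:ℝ), F (a * t) := by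
      refine setLIntegral_congr_fun measurableSet_Ioi ?_
      intro t ht
      have ht : 0 < t := ht
      have e1 : (a * t) ^ θ = d * t ^ θ := by
        rw [Real.mul_rpow ha0.le ht.le, ha, ← Real.rpow_mul hd0.le, one_div_mul_cancel hθ0.ne',
          Real.rpow_one]
      have e2 : d ^ β * (a * t) ^ (-(1/q)) = d ^ (1-ε) * t ^ (-(1/q)) := by
        rw [Real.mul_rpow ha0.le ht.le, ha, ← Real.rpow_mul hd0.le, ← mul_assoc,
          ← Real.rpow_add hd0]
        congr 2
        rw [hβ]; field_simp; ring
      simp only [f, F, x]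
      rw [e1, ← mul_assoc (d ^ β), e2, hL]
      congr 2
      ring
    rw [h1, lint_scale F ha0]
    have h2 : ∫⁻ t in Ioi (0:ℝ), F t ≤ ENNReal.ofReal (D * K * d ^ (β * r)) * I := by
      rw [hI, ← lintegral_const_mul' _ _ ENNReal.ofReal_ne_top]
      refine setLIntegral_mono' measurableSet_Ioi ?_
      intro t ht
      have ht : 0 < t := ht
      have hgt := hg0 (t ^ θ) (mem_Ioi.2 (by positivity))
      rw [← ENNReal.ofReal_mul (by positivity)]
      apply ENNReal.ofReal_le_ofReal
      refine (hD _ (by positivity)).trans ?_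
      have := hK (d ^ β) (t ^ (-(1/q)) * g (t ^ θ)) (by positivity)
        (Real.rpow_le_one hd0.le hd1 hβ0.le) (by positivity)
      rw [← Real.rpow_mul hd0.le] at this
      calc _ ≤ D * (K * d ^ (β * r) * Φ (t ^ (-(1/q)) * g (t ^ θ))) := by gcongr
        _ = _ := by ring
    refine (mul_le_mul_right h2 _).trans (le_of_eq ?_)
    rw [← mul_assoc, ← ENNReal.ofReal_mul (by positivity)]
    congr 2
    have e3 : a⁻¹ * d ^ (β * r) = ρ ^ (k+1) := by
      rw [ha, ← Real.rpow_neg hd0.le, ← Real.rpow_add hd0, hρ, hd, ← Real.rpow_natCast,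
        ← Real.rpow_natCast, ← Real.rpow_mul (by norm_num), ← Real.rpow_mul (by norm_num)]
      congr 1
      rw [hγ]; ring
    rw [← e3]; ring
  have hH : ∫⁻ t in Ioi (0:ℝ), ∑' k, f k t ≤ ENNReal.ofReal C * I := by
    rw [lintegral_tsum hfm, hC, ENNReal.ofReal_tsum_of_nonneg (fun k => by positivity) hsum,
      ← ENNReal.tsum_mul_right]
    exact ENNReal.tsum_le_tsum hfk
  have hS0 : ∀ s, 0 < s → 0 ≤ S1inf g s := by
    intro s hs
    refine mul_nonneg (inv_nonneg.2 hs.le) ?_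
    rw [intervalIntegral.integral_of_le hs.le]
    exact setIntegral_nonneg measurableSet_Ioc (fun y hy => hg0 y hy.1)
  constructor
  · have hint : ∀ s, 0 < s → IntervalIntegrable g volume 0 s := by
      intro s hs
      have hae : ∀ᵐ t ∂(volume.restrict (Ioi (0:ℝ))), ∑' k, f k t < ⊤ := by
        refine ae_lt_top' (AEMeasurable.ennreal_tsum hfm) ?_
        exact (hH.trans_lt (ENNReal.mul_lt_top ENNReal.ofReal_lt_top hfin)).ne
      obtain ⟨t, hts, htf⟩ : ∃ t, s ^ (1/θ) < t ∧ ∑' k, f k t < ⊤ := by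
        by_contra! hcon
        have hsub : Ioi (s ^ (1/θ)) ⊆ Ioi (0:ℝ) := fun y hy =>
          lt_trans (show (0:ℝ) < s ^ (1/θ) by positivity) hy
        have h5 := ae_mono (Measure.restrict_mono hsub le_rfl) hae
        have h6 : ∀ᵐ t ∂(volume.restrict (Ioi (s ^ (1/θ)))), False := by
          filter_upwards [h5, ae_restrict_mem measurableSet_Ioi] with t h7 h8
          exact absurd h7 (not_lt.2 (hcon t h8))
        rw [eventually_false_iff_eq_bot, ae_eq_bot, Measure.restrict_eq_zero] at h6
        simp at h6
      have ht0 : 0 < t := lt_trans (by positivity) hts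
      have hst : s ≤ t ^ θ := by
        calc s = (s ^ (1/θ)) ^ θ := by
              rw [← Real.rpow_mul hs.le, one_div_mul_cancel hθ0.ne', Real.rpow_one]
          _ ≤ _ := by gcongr
      obtain ⟨B, hB⟩ := (hΦ.tendsto_atTop.eventually_gt_atTop
        (∑' k, f k t).toReal).exists_forall_of_atTop
      have hbd : ∀ k, x k (t ^ θ) ≤ B / (2 * t ^ (-(1/q))) := by
        intro k
        have hxk := hx0 k (t ^ θ) (by positivity)
        by_contra! hlt
        rw [div_lt_iff₀ (by positivity)] at hlt
        have h7 := hB (t ^ (-(1/q)) * (2 * x k (t ^ θ))) (by linarith)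
        have h8 : f k t ≤ ∑' k, f k t := ENNReal.le_tsum k
        have h9 := ENNReal.toReal_mono htf.ne h8
        simp only [f] at h9 h7
        rw [ENNReal.toReal_ofReal (orl_nonneg hΦ (by positivity))] at h9
        linarith
      have h10 := (key_int hg0 hg hε0 hε1 (by positivity) hbd).1
      refine h10.mono_set ?_
      rw [uIcc_of_le hs.le, uIcc_of_le (hs.le.trans hst)]
      exact Icc_subset_Icc_right hst
    rw [ENNReal.ofReal_one, one_mul]
    refine setLIntegral_mono' measurableSet_Ioi ?_
    intro t ht
    have ht : 0 < t := ht
    have hs : 0 < t ^ θ := by positivity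
    have hgt := hg0 (t ^ θ) hs
    have hSt := hS0 (t ^ θ) hs
    apply ENNReal.ofReal_le_ofReal
    refine hΦ.monotoneOn (mem_Ici.2 (by positivity)) (mem_Ici.2 (by positivity)) ?_
    gcongr
    set s := t ^ θ
    rw [S1inf, inv_mul_eq_div, le_div_iff₀ hs]
    have h11 : ∫ y in (0:ℝ)..s, g s ≤ ∫ y in (0:ℝ)..s, g y := by
      have h12 := hint s hs
      rw [intervalIntegral.integral_of_le hs.le, intervalIntegral.integral_of_le hs.le]
      rw [intervalIntegrable_iff_integrableOn_Ioc_of_le hs.le] at h12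
      refine setIntegral_mono_on (by simp) h12 measurableSet_Ioc ?_
      intro y hy
      exact hg hy.1 hs hy.2
    rw [intervalIntegral.integral_const, smul_eq_mul, sub_zero] at h11
    linarith
  · refine le_trans (setLIntegral_mono' measurableSet_Ioi ?_) hH
    intro t ht
    have ht : 0 < t := ht
    have hs : 0 < t ^ θ := by positivity
    have hSt := hS0 (t ^ θ) hs
    rcases hSt.eq_or_lt with h0 | hpos
    · rw [← h0, mul_zero, hΦ.map_zero]; simp
    obtain ⟨k, hk⟩ : ∃ k, S1inf g (t ^ θ) / 2 < x k (t ^ θ) := by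
      by_contra! hcon
      have := (key_int hg0 hg hε0 hε1 hs hcon).2
      linarith
    refine le_trans ?_ (ENNReal.le_tsum k)
    apply ENNReal.ofReal_le_ofReal
    have hxk := hx0 k (t ^ θ) hs
    refine hΦ.monotoneOn (mem_Ici.2 (by positivity)) (mem_Ici.2 (by positivity)) ?_
    gcongr
    linarith
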